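/- Let R = (r_{st}) be an n×n matrix over the complex numbers and let l be the number of non-zero entries of R. For 1 ≤ i, j ≤ n, let R_{ij} be the matrix obtained from R by replacing the (i,j) entry by 0. Then (l − n)·d₂(R) = Σ_{(i,j)∈I} d₂(R_{ij}), where I = {(i,j) : r_{ij} ≠ 0, 1 ≤ i, j ≤ n}. -/

import Mathlib

open Matrix Finset

/-- The second immanant `d₂(M) = Σ_i M i i * det (M(i)) - det M`, where `M(i)` is the
submatrix of `M` obtained by deleting row `i` and column `i`. -/
noncomputable def d2 {α : Type*} [Fintype α] [DecidableEq α] (M : Matrix α α ℂ) : ℂ :=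
  (∑ i, M i i *
    (M.submatrix (fun k : {k : α // k ≠ i} => (k : α))
      (fun k : {k : α // k ≠ i} => (k : α))).det) - M.det

/-- A product of a matrix entry with its complementary principal minor is the part of the
determinant indexed by the permutations fixing that index. -/
theorem mul_det_principal_minor {α : Type*} [Fintype α] [DecidableEq α] (M : Matrix α α ℂ)
    (i : α) :
    M i i * (M.submatrix (fun k : {k : α // k ≠ i} => (k : α))
        (fun k : {k : α // k ≠ i} => (k : α))).det
      = ∑ σ : Equiv.Perm α, if σ i = i then
          ((Equiv.Perm.sign σ : ℤ) : ℂ) * ∏ b, M (σ b) b else 0 := by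
  set N : Matrix α α ℂ := Matrix.of fun a b => if a = i ∧ b ≠ i then 0 else M a b with hN
  have hminor : N.toSquareBlockProp (fun k => k ≠ i) =
      M.submatrix (fun k : {k : α // k ≠ i} => (k : α))
        (fun k : {k : α // k ≠ i} => (k : α)) := by
    ext ⟨a, ha⟩ ⟨b, hb⟩
    simp [hN, Matrix.toSquareBlockProp, ha]
  have hcorner : (N.toSquareBlockProp (fun k => ¬ k ≠ i)).det = M i i := by
    let _ : Unique {k : α // ¬ k ≠ i} :=
      { default := ⟨i, by simp⟩
        uniq := fun a => Subtype.ext (not_not.mp a.2) }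
    rw [Matrix.det_unique]
    change N i i = M i i
    simp [hN]
  have hdet := Matrix.twoBlockTriangular_det N (fun k => k ≠ i) (by
    intro a ha b hb
    simp [hN, not_not.mp ha, hb])
  rw [hminor, hcorner, mul_comm] at hdet
  rw [← hdet, Matrix.det_apply']
  refine Finset.sum_congr rfl fun σ _ => ?_
  split_ifs with h
  · congr 1
    refine Finset.prod_congr rfl fun b _ => ?_
    have hb : ¬ (σ b = i ∧ b ≠ i) := fun hb => hb.2 (σ.injective (hb.1.trans h.symm))
    simp only [hN, Matrix.of_apply, if_neg hb]
  · have hne : σ.symm i ≠ i := fun h' => h (by rw [← h', σ.apply_symm_apply, h'])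
    rw [Finset.prod_eq_zero (Finset.mem_univ (σ.symm i)), mul_zero]
    simp [hN, hne]

/-- The second immanant as a sum over permutations, weighted by the number of fixed points
minus one. -/
theorem d2_eq_sum_perm {α : Type*} [Fintype α] [DecidableEq α] (M : Matrix α α ℂ) :
    d2 M = ∑ σ : Equiv.Perm α, ((∑ i, if σ i = i then (1 : ℂ) else 0) - 1) *
      ((Equiv.Perm.sign σ : ℤ) : ℂ) * ∏ b, M (σ b) b := by
  unfold d2
  simp_rw [mul_det_principal_minor]
  rw [Finset.sum_comm, Matrix.det_apply', ← Finset.sum_sub_distrib]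
  refine Finset.sum_congr rfl fun σ _ => ?_
  rw [mul_assoc, sub_mul, one_mul, Finset.sum_mul]
  simp

/-- Summing the diagonal product of `σ` over all ways of zeroing one entry in the support `I`
of `R`: only the entries off the graph of `σ` contribute. -/
theorem sum_prod_zeroed_entries {α : Type*} [Fintype α] [DecidableEq α] (R : Matrix α α ℂ)
    (I : Finset (α × α)) (hI : ∀ p, p ∈ I ↔ R p.1 p.2 ≠ 0) (σ : Equiv.Perm α) :
    ∑ p ∈ I, ∏ b, (if σ b = p.1 ∧ b = p.2 then (0 : ℂ) else R (σ b) b)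
      = ((I.card : ℂ) - Fintype.card α) * ∏ b, R (σ b) b := by
  have hterm (p : α × α) : ∏ b, (if σ b = p.1 ∧ b = p.2 then (0 : ℂ) else R (σ b) b)
      = (1 - if σ p.2 = p.1 then (1 : ℂ) else 0) * ∏ b, R (σ b) b := by
    split_ifs with h
    · rw [Finset.prod_eq_zero (Finset.mem_univ p.2) (by simp [h])]
      simp
    · rw [sub_zero, one_mul]
      refine Finset.prod_congr rfl fun b _ => if_neg ?_
      rintro ⟨h₁, rfl⟩
      exact h h₁
  simp_rw [hterm]
  rw [← Finset.sum_mul]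
  by_cases h0 : ∏ b, R (σ b) b = 0
  · simp [h0]
  congr 1
  have hmem (b : α) : (σ b, b) ∈ I :=
    (hI _).2 (Finset.prod_ne_zero_iff.mp h0 b (Finset.mem_univ b))
  have himage : I.filter (fun p => σ p.2 = p.1) = Finset.univ.image fun b => (σ b, b) := by
    ext ⟨a, b⟩
    simp only [Finset.mem_filter, Finset.mem_image, Finset.mem_univ, true_and, Prod.mk.injEq]
    constructor
    · rintro ⟨-, h⟩
      exact ⟨b, h, rfl⟩
    · rintro ⟨c, rfl, rfl⟩
      exact ⟨hmem c, rfl⟩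
  have hcard : (Finset.univ.image fun b => (σ b, b)).card = Fintype.card α :=
    Finset.card_image_of_injective _ fun a b h => (Prod.mk.inj h).2
  rw [Finset.sum_sub_distrib, Finset.sum_boole, himage, hcard]
  simp

open Classical in
/-- Let `R` be an `n × n` matrix over `ℂ` and `l` the number of non-zero
entries of `R`. For indices `i, j`, let `R_{ij}` be the matrix obtained from `R` by replacing
the `(i,j)` entry by `0`. Then `(l - n) * d₂(R) = Σ_{(i,j) ∈ I} d₂(R_{ij})`, where
`I = {(i,j) | R i j ≠ 0}`. -/
theorem d2_sum_zeroed_nonzero_entries {n l : ℕ} (R : Matrix (Fin n) (Fin n) ℂ)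
    (hl : (Finset.univ.filter (fun p : Fin n × Fin n => R p.1 p.2 ≠ 0)).card = l) :
    ((l : ℂ) - (n : ℂ)) * d2 R
      = ∑ p ∈ Finset.univ.filter (fun p : Fin n × Fin n => R p.1 p.2 ≠ 0),
          d2 (Matrix.of fun a b => if a = p.1 ∧ b = p.2 then (0 : ℂ) else R a b) := by
  simp_rw [d2_eq_sum_perm, Matrix.of_apply]
  rw [Finset.sum_comm, Finset.mul_sum]
  refine Finset.sum_congr rfl fun σ _ => ?_
  rw [← Finset.mul_sum]
  have h := sum_prod_zeroed_entries R
    (Finset.univ.filter (fun p : Fin n × Fin n => R p.1 p.2 ≠ 0)) (by simp) σ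
  rw [hl, Fintype.card_fin] at h
  rw [h]
  ring
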